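/- For every n ≥ 1 there exists a constant C, depending only on n, with the following property: if f : ℝⁿ → ℝ is a twice continuously differentiable convex function attaining the minimal value 0, and λ > 0 is such that det(D²f(x)) ≥ λ for all x in K := {x ∈ ℝⁿ : f(x) ≤ 1}, then the Lebesgue measure of K satisfies Vol(K) ≤ C λ^{−1/2}. -/

import Mathlib

open scoped RealInnerProductSpace
open MeasureTheory

/-- The Hessian determinant `det (D²f(x))`. -/
noncomputable def hessDet {n : ℕ} (f : EuclideanSpace ℝ (Fin n) → ℝ)
    (x : EuclideanSpace ℝ (Fin n)) : ℝ :=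
  LinearMap.det (fderiv ℝ (gradient f) x).toLinearMap

open Module

/-- A convex set contains the simplex spanned by any of its points. -/
lemma Convex.add_sum_smul_sub_mem {ι E : Type*} [Fintype ι] [AddCommGroup E] [Module ℝ E]
    {K : Set E} (hK : Convex ℝ K) {x : E} (hx : x ∈ K) {v : ι → E} (hv : ∀ i, v i ∈ K)
    {a : ι → ℝ} (ha : ∀ i, 0 ≤ a i) (ha' : ∑ i, a i ≤ 1) :
    x + ∑ i, a i • (v i - x) ∈ K := by
  have h := hK.sum_mem (t := Finset.univ)
    (w := fun o : Option ι => o.elim (1 - ∑ i, a i) a) (z := fun o => o.elim x v)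
    (by rintro (_ | i) - <;> simp [ha, ha']) (by simp [Fintype.sum_option])
    (by rintro (_ | i) - <;> simp [hx, hv])
  convert h using 1
  simp only [Fintype.sum_option, Option.elim, smul_sub, Finset.sum_sub_distrib, sub_smul,
    one_smul, Finset.sum_smul]
  abel

section EuclideanSpace

variable {n : ℕ}

local notation "E" => EuclideanSpace ℝ (Fin n)

/-- The coordinate cube `{|x i| ≤ r}` has finite volume. -/
lemma volume_cube_ne_top (r : ℝ) : volume {x : E | ∀ i, |x i| ≤ r} ≠ ⊤ := by
  refine ((isBounded_iff_forall_norm_le.2 ⟨√(n * r ^ 2), fun x hx => ?_⟩).measure_lt_top).ne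
  rw [EuclideanSpace.norm_eq]
  refine Real.sqrt_le_sqrt ?_
  calc ∑ i, ‖x i‖ ^ 2 ≤ ∑ _i : Fin n, r ^ 2 :=
        Finset.sum_le_sum fun i _ => pow_le_pow_left₀ (norm_nonneg _) (hx i) 2
    _ = n * r ^ 2 := by simp

lemma linearMap_det_constr (v : Fin n → E) :
    LinearMap.det ((EuclideanSpace.basisFun (Fin n) ℝ).toBasis.constr ℝ v) =
      (EuclideanSpace.basisFun (Fin n) ℝ).toBasis.det v := by
  set e := (EuclideanSpace.basisFun (Fin n) ℝ).toBasis
  have h := e.det_comp (e.constr ℝ v) e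
  rw [e.det_self, mul_one] at h
  rw [← h]
  congr 1
  ext1 i
  simp

lemma constr_basisFun_apply (v : Fin n → E) (a : E) :
    (EuclideanSpace.basisFun (Fin n) ℝ).toBasis.constr ℝ v a = ∑ i, a i • v i := by
  simp [Basis.constr_apply_fintype]

/-- The simplices with vertices in a convex set of finite volume have bounded volume. -/
lemma exists_forall_abs_det_le {K : Set E} (hK : Convex ℝ K) (hKv : volume K ≠ ⊤) {x : E}
    (hx : x ∈ K) :
    ∃ M : ℝ, ∀ v : Fin n → E, (∀ i, v i ∈ K) →
      |(EuclideanSpace.basisFun (Fin n) ℝ).toBasis.det (fun i => v i - x)| ≤ M := by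
  set Δ : Set E := {a | ∀ i, a i ∈ Set.Ioo (0 : ℝ) ((n : ℝ)⁻¹)} with hΔ
  have hΔo : IsOpen Δ := by
    simp only [hΔ, Set.ofPred_forall]
    exact isOpen_iInter_of_finite fun i => isOpen_Ioo.preimage (by fun_prop)
  have hΔn : Δ.Nonempty := by
    refine ⟨WithLp.toLp 2 fun _ => (n : ℝ)⁻¹ / 2, fun i => ?_⟩
    have : (0 : ℝ) < (n : ℝ)⁻¹ := inv_pos.2 (by exact_mod_cast i.pos)
    simp only [Set.mem_Ioo]
    constructor <;> linarith
  have hpos : volume Δ ≠ 0 := (hΔo.measure_pos volume hΔn).ne'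
  refine ⟨(volume K / volume Δ).toReal, fun v hv => ?_⟩
  rw [← linearMap_det_constr, ← ENNReal.ofReal_le_iff_le_toReal (ENNReal.div_ne_top hKv hpos)]
  set A := (EuclideanSpace.basisFun (Fin n) ℝ).toBasis.constr ℝ (fun i => v i - x) with hA
  rw [ENNReal.le_div_iff_mul_le (.inl hpos) (.inr hKv), ← Measure.addHaar_image_linearMap,
    ← measure_preimage_add volume x K]
  refine measure_mono ?_
  rintro _ ⟨a, ha, rfl⟩
  rw [hA, constr_basisFun_apply, Set.mem_preimage]
  refine hK.add_sum_smul_sub_mem hx hv (fun i => (ha i).1.le) ?_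
  calc ∑ i, a i ≤ ∑ _i : Fin n, (n : ℝ)⁻¹ := Finset.sum_le_sum fun i _ => (ha i).2.le
    _ ≤ 1 := by simpa using mul_inv_le_one

/-- Inside a convex body there is a simplex of almost maximal volume; the body is comparable to
the parallelepiped it spans. -/
lemma exists_basis_forall_abs_repr_le {K : Set E} (hK : Convex ℝ K) (hKv : volume K ≠ ⊤) {x : E}
    (hx : x ∈ interior K) :
    ∃ B : Basis (Fin n) ℝ E, (∀ i, x + B i ∈ K) ∧ ∀ z ∈ K, ∀ i, |B.repr (z - x) i| ≤ 2 := by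
  set e := (EuclideanSpace.basisFun (Fin n) ℝ).toBasis with he
  have hxK := interior_subset hx
  obtain ⟨M, hM⟩ := exists_forall_abs_det_le hK hKv hxK
  set S : Set ℝ := (fun v : Fin n → E => |e.det fun i => v i - x|) '' {v | ∀ i, v i ∈ K} with hS
  have hSb : BddAbove S := ⟨M, by rintro _ ⟨v, hv, rfl⟩; exact hM v hv⟩
  obtain ⟨s, hs, hspos⟩ : ∃ s ∈ S, 0 < s := by
    obtain ⟨r, hr, hball⟩ := Metric.isOpen_iff.1 isOpen_interior x hx
    refine ⟨_, ⟨fun i => x + (r / 2) • e i, fun i => interior_subset (hball ?_), rfl⟩, ?_⟩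
    · simp [he, norm_smul, abs_of_pos hr, hr]
    · simp only [add_sub_cancel_left, abs_pos]
      have h := e.det.toMultilinearMap.map_smul_univ (fun _ => r / 2) e
      simp only [AlternatingMap.coe_multilinearMap, e.det_self] at h
      rw [h]
      simp [hr.ne']
  have hsup : 0 < sSup S := hspos.trans_le (le_csSup hSb hs)
  obtain ⟨_, ⟨v, hv, rfl⟩, hlt⟩ := exists_lt_of_lt_csSup ⟨s, hs⟩ (half_lt_self hsup)
  have hdet : 0 < |e.det fun i => v i - x| := (half_pos hsup).trans hlt
  obtain ⟨hli, hsp⟩ := e.is_basis_iff_det.2 (abs_pos.1 hdet).isUnit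
  refine ⟨Basis.mk hli hsp.ge, fun i => by simpa using hv i, fun z hz i => ?_⟩
  have h := DFunLike.congr_fun (e.det_smul_mk_coord_eq_det_update hli hsp.ge i) (z - x)
  have hle : |e.det fun j => Function.update v i z j - x| ≤ sSup S := by
    refine le_csSup hSb ⟨_, fun j => ?_, rfl⟩
    rcases eq_or_ne j i with rfl | hj
    · simpa using hz
    · simpa [hj] using hv j
  have hup : (fun j => Function.update v i z j - x) =
      Function.update (fun j => v j - x) i (z - x) := by
    ext1 j
    rcases eq_or_ne j i with rfl | hj
    · simp
    · simp [hj]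
  simp only [LinearMap.smul_apply, smul_eq_mul, MultilinearMap.toLinearMap_apply,
    AlternatingMap.coe_multilinearMap, Basis.coord_apply, ← hup] at h
  rw [← h, abs_mul] at hle
  refine le_of_mul_le_mul_left ?_ hdet
  linarith

/-- A weak form of the Blaschke–Santaló inequality: a convex body has a point about which the
volume of the (dilated) polar body is at most a constant over the volume of the body. -/
lemma exists_volume_mul_volume_polar_le (n : ℕ) (r : ℝ) :
    ∃ C : ENNReal, C ≠ ⊤ ∧ ∀ K : Set (EuclideanSpace ℝ (Fin n)), Convex ℝ K → volume K ≠ ⊤ →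
      (interior K).Nonempty → ∃ c ∈ K,
        volume K * volume {p : EuclideanSpace ℝ (Fin n) | ∀ z ∈ K, ⟪p, z - c⟫ ≤ r} ≤ C := by
  refine ⟨volume {x : EuclideanSpace ℝ (Fin n) | ∀ i, |x i| ≤ 2} *
    volume {x : EuclideanSpace ℝ (Fin n) | ∀ i, |x i| ≤ (n + 1) * r},
    ENNReal.mul_ne_top (volume_cube_ne_top _) (volume_cube_ne_top _), fun K hK hKv ⟨x, hx⟩ => ?_⟩
  obtain ⟨B, hBK, hB⟩ := exists_basis_forall_abs_repr_le hK hKv hx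
  have hxK := interior_subset hx
  set A := (EuclideanSpace.basisFun (Fin n) ℝ).toBasis.constr ℝ B with hA
  have hdet : LinearMap.det A ≠ 0 := by
    rw [hA, linearMap_det_constr]
    exact (Basis.isUnit_det _ B).ne_zero
  have hdet' : LinearMap.det A.adjoint = LinearMap.det A := by
    set b := EuclideanSpace.basisFun (Fin n) ℝ
    rw [← LinearMap.det_toMatrix b.toBasis, LinearMap.toMatrix_adjoint,
      Matrix.det_conjTranspose, LinearMap.det_toMatrix, star_trivial]
  have hn : (0 : ℝ) < n + 1 := by positivity
  set d : EuclideanSpace ℝ (Fin n) := ∑ i, ((n : ℝ) + 1)⁻¹ • B i with hd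
  have hc : x + d ∈ K := by
    have h := hK.add_sum_smul_sub_mem (v := fun i => x + B i) (a := fun _ => ((n : ℝ) + 1)⁻¹)
      hxK hBK (fun _ => by positivity) (by simp; field_simp; linarith)
    simpa using h
  refine ⟨x + d, hc, ?_⟩
  have h1 : volume K ≤ ENNReal.ofReal |LinearMap.det A| *
      volume {x : EuclideanSpace ℝ (Fin n) | ∀ i, |x i| ≤ 2} := by
    rw [← Measure.addHaar_image_linearMap, ← measure_preimage_add volume x K]
    refine measure_mono fun z hz => ⟨WithLp.toLp 2 (B.repr z), fun i => ?_, ?_⟩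
    · simpa using hB (x + z) hz i
    · rw [hA, constr_basisFun_apply]
      exact B.sum_repr z
  have h2 : volume {p : EuclideanSpace ℝ (Fin n) | ∀ z ∈ K, ⟪p, z - (x + d)⟫ ≤ r} ≤
      ENNReal.ofReal |(LinearMap.det A)⁻¹| *
        volume {x : EuclideanSpace ℝ (Fin n) | ∀ i, |x i| ≤ (n + 1) * r} := by
    rw [← hdet', ← Measure.addHaar_preimage_linearMap _ (hdet' ▸ hdet)]
    refine measure_mono fun p hp i => ?_
    have hcoord : ∀ i, A.adjoint p i = ⟪p, B i⟫ := fun i => by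
      rw [← EuclideanSpace.basisFun_inner (Fin n) ℝ (A.adjoint p) i, real_inner_comm,
        LinearMap.adjoint_inner_left, hA]
      congr 1
      simp
    have hx0 : -⟪p, d⟫ ≤ r := by simpa using hp x hxK
    have hxi : ∀ i, ⟪p, B i⟫ - ⟪p, d⟫ ≤ r := fun i => by
      simpa [inner_sub_right] using hp _ (hBK i)
    have hpd : (n + 1) * ⟪p, d⟫ = ∑ i, ⟪p, B i⟫ := by
      rw [hd, ← Finset.smul_sum, inner_smul_right, inner_sum, mul_inv_cancel_left₀ hn.ne']
    have hsum : r + ⟪p, d⟫ - ⟪p, B i⟫ ≤ n * r - ⟪p, d⟫ := by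
      calc r + ⟪p, d⟫ - ⟪p, B i⟫ ≤ ∑ j, (r + ⟪p, d⟫ - ⟪p, B j⟫) :=
            Finset.single_le_sum (f := fun j => r + ⟪p, d⟫ - ⟪p, B j⟫)
              (fun j _ => by linarith [hxi j]) (Finset.mem_univ i)
        _ = n * r - ⟪p, d⟫ := by
            rw [Finset.sum_sub_distrib, ← hpd]
            simp
            ring
    have hi := hxi i
    rw [hcoord, abs_le]
    constructor <;> linarith
  calc _ ≤ _ := mul_le_mul' h1 h2
    _ = (ENNReal.ofReal |LinearMap.det A| * ENNReal.ofReal |(LinearMap.det A)⁻¹|) *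
        (volume {x : EuclideanSpace ℝ (Fin n) | ∀ i, |x i| ≤ 2} *
        volume {x : EuclideanSpace ℝ (Fin n) | ∀ i, |x i| ≤ (n + 1) * r}) := by ring
    _ = _ := by
      rw [← ENNReal.ofReal_mul (abs_nonneg _), ← abs_mul, mul_inv_cancel₀ hdet]
      simp

end EuclideanSpace

section Gradient

variable {F : Type*} [NormedAddCommGroup F] [InnerProductSpace ℝ F] [CompleteSpace F]

/-- A differentiable convex function lies above its tangent hyperplanes. -/
lemma ConvexOn.add_inner_gradient_le {f : F → ℝ} (hf : ConvexOn ℝ Set.univ f) {x : F}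
    (hd : DifferentiableAt ℝ f x) (y : F) : f x + ⟪gradient f x, y - x⟫ ≤ f y := by
  have hg : ConvexOn ℝ Set.univ (f ∘ AffineMap.lineMap (k := ℝ) x y) :=
    hf.comp_affineMap (AffineMap.lineMap x y)
  have hd' : HasFDerivAt f (fderiv ℝ f x) (AffineMap.lineMap x y (0 : ℝ)) := by
    simpa using hd.hasFDerivAt
  have h := hg.le_slope_of_hasDerivAt (Set.mem_univ 0) (Set.mem_univ 1) one_pos
    (hd'.comp_hasDerivAt (0 : ℝ) AffineMap.hasDerivAt_lineMap)
  rw [inner_gradient_left]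
  simp only [slope_def_field, Function.comp_apply, AffineMap.lineMap_apply_one,
    AffineMap.lineMap_apply_zero, sub_zero, div_one] at h
  linarith

/-- If a convex function has the same gradient at two points, then it has this gradient on the
whole segment between them. -/
lemma ConvexOn.gradient_lineMap_eq {f : F → ℝ} (hf : ConvexOn ℝ Set.univ f)
    (hd : Differentiable ℝ f) {x y : F} (hxy : gradient f x = gradient f y) {t : ℝ}
    (ht : t ∈ Set.Icc (0 : ℝ) 1) : gradient f (AffineMap.lineMap x y t) = gradient f x := by
  set p := gradient f x with hp
  have hx := fun w => hf.add_inner_gradient_le (hd x) w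
  have hy := hf.add_inner_gradient_le (hd y) x
  rw [← hxy] at hy
  rw [← hp] at hx
  set z := AffineMap.lineMap x y t with hz
  have hzeq : z = (1 - t) • x + t • y := by rw [hz, AffineMap.lineMap_apply_module]
  have hfz : f z ≤ (1 - t) * f x + t * f y := by
    rw [hzeq]
    exact hf.2 (Set.mem_univ x) (Set.mem_univ y) (by linarith [ht.2]) ht.1 (by ring)
  have hpz : ⟪p, z⟫ = (1 - t) * ⟪p, x⟫ + t * ⟪p, y⟫ := by
    rw [hzeq, inner_add_right, inner_smul_right, inner_smul_right]
  have hmin : IsLocalMin (fun w => f w - innerSL ℝ p w) z := by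
    refine Filter.Eventually.of_forall fun w => ?_
    have hw := hx w
    simp only [inner_sub_right] at hw hy
    simp only [innerSL_apply_apply]
    nlinarith [mul_nonneg ht.1 (by linarith : (0 : ℝ) ≤ f x - ⟪p, x⟫ - (f y - ⟪p, y⟫))]
  have h0 := hmin.hasFDerivAt_eq_zero ((hd z).hasFDerivAt.sub (innerSL ℝ p).hasFDerivAt)
  refine ext_inner_right ℝ fun w => ?_
  rw [inner_gradient_left, sub_eq_zero.1 h0, innerSL_apply_apply]

/-- The gradient of a `C²` convex function separates a point with nondegenerate Hessian from every
other point. -/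
lemma ConvexOn.eq_of_gradient_eq {f : F → ℝ} (hf : ConvexOn ℝ Set.univ f)
    (hd : Differentiable ℝ f) {x y : F} (hd' : DifferentiableAt ℝ (gradient f) x)
    (hker : (fderiv ℝ (gradient f) x).ker = ⊥) (hxy : gradient f x = gradient f y) : x = y := by
  have h1 : HasFDerivAt (gradient f) (fderiv ℝ (gradient f) x)
      (AffineMap.lineMap x y (0 : ℝ)) := by simpa using hd'.hasFDerivAt
  have h2 := (h1.comp_hasDerivAt (0 : ℝ) AffineMap.hasDerivAt_lineMap).hasDerivWithinAt
    (s := Set.Icc 0 1)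
  have h3 : HasDerivWithinAt (gradient f ∘ AffineMap.lineMap (k := ℝ) x y) 0 (Set.Icc 0 1) 0 :=
    (hasDerivWithinAt_const _ _ (gradient f x)).congr
      (fun t ht => hf.gradient_lineMap_eq hd hxy ht) (by simp)
  have h4 := (uniqueDiffOn_Icc_zero_one 0 (by simp)).eq_deriv _ h2 h3
  have h5 : y - x ∈ (fderiv ℝ (gradient f) x).ker := by simpa using h4
  rw [hker] at h5
  exact (sub_eq_zero.1 (by simpa using h5)).symm

lemma ContDiff.gradient {f : F → ℝ} (hf : ContDiff ℝ 2 f) : ContDiff ℝ 1 (gradient f) :=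
  (InnerProductSpace.toDual ℝ F).symm.toContinuousLinearEquiv.contDiff.comp
    (hf.fderiv_right (m := 1) (by norm_num))

end Gradient

/-- If `det D²f ≥ lam` on a measurable set, the gradient map of a convex function `f` expands
its volume by a factor at least `lam`. -/
lemma ofReal_mul_volume_le_volume_gradient_image {n : ℕ} {f : EuclideanSpace ℝ (Fin n) → ℝ}
    (hf : ContDiff ℝ 2 f) (hconv : ConvexOn ℝ Set.univ f) {lam : ℝ} (hlam : 0 < lam)
    {S : Set (EuclideanSpace ℝ (Fin n))} (hS : NullMeasurableSet S)
    (hdet : ∀ x ∈ S, lam ≤ hessDet f x) :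
    ENNReal.ofReal lam * volume S ≤ volume (gradient f '' S) := by
  have hd : Differentiable ℝ f := hf.differentiable (by norm_num)
  have hd' : Differentiable ℝ (gradient f) := hf.gradient.differentiable (by norm_num)
  have hinj : Set.InjOn (gradient f) S := fun x hx y _ hxy => by
    refine hconv.eq_of_gradient_eq hd (hd' x) ?_ hxy
    by_contra hker
    have h0 : hessDet f x = 0 := LinearMap.det_eq_zero_iff_ker_ne_bot.2 hker
    linarith [hdet x hx]
  rw [← lintegral_abs_det_fderiv_eq_addHaar_image₀ volume hS
    (fun x _ => (hd' x).hasFDerivAt.hasFDerivWithinAt) hinj, ← setLIntegral_const]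
  refine lintegral_mono_ae ?_
  filter_upwards [ae_restrict_mem₀ hS] with x hx
  exact ENNReal.ofReal_le_ofReal ((hdet x hx).trans (le_abs_self _))

/-- Lemma 5.2 (Donaldson, Proposition 2): if a `C²` convex function `f` with
minimal value `0` has `det D²f ≥ λ` on `K = {f ≤ 1}`, then
`Vol(K) ≤ C λ^{-1/2}` for a dimensional constant `C`. -/
theorem stmt6 {n : ℕ} (hn : 1 ≤ n) :
    ∃ C : ℝ, ∀ (f : EuclideanSpace ℝ (Fin n) → ℝ) (lam : ℝ),
      ContDiff ℝ 2 f → ConvexOn ℝ Set.univ f →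
      (∀ x, 0 ≤ f x) → (∃ x, f x = 0) → 0 < lam →
      (∀ x ∈ {x : EuclideanSpace ℝ (Fin n) | f x ≤ 1}, lam ≤ hessDet f x) →
      (volume {x : EuclideanSpace ℝ (Fin n) | f x ≤ 1}).toReal
        ≤ C * lam ^ (-(1 : ℝ) / 2) := by
  obtain ⟨C, hC, hpolar⟩ := exists_volume_mul_volume_polar_le n 2
  refine ⟨√(2 ^ n * C.toReal), fun f lam hf hconv hnonneg ⟨x₀, hx₀⟩ hlam hdet => ?_⟩
  set K := {x : EuclideanSpace ℝ (Fin n) | f x ≤ 1} with hK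
  rcases eq_or_ne (volume K) ⊤ with htop | hKv
  · rw [htop, ENNReal.toReal_top]
    positivity
  have hd : Differentiable ℝ f := hf.differentiable (by norm_num)
  have hKc : Convex ℝ K := by simpa using hconv.convex_le 1
  have hKi : (interior K).Nonempty :=
    ⟨x₀, mem_interior_iff_mem_nhds.2 <| Filter.mem_of_superset
      ((isOpen_Iio.preimage hf.continuous).mem_nhds (by simp [hx₀] : x₀ ∈ f ⁻¹' Set.Iio 1))
      fun x hx => show f x ≤ 1 from (Set.mem_Iio.1 hx).le⟩
  obtain ⟨c, hc, hle⟩ := hpolar K hKc hKv hKi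
  set K' := AffineMap.homothety c (1 / 2 : ℝ) '' K with hK'
  have hsub : K' ⊆ K := by
    rintro _ ⟨k, hk, rfl⟩
    rw [AffineMap.homothety_eq_lineMap]
    exact hKc.lineMap_mem hc hk ⟨by norm_num, by norm_num⟩
  have hK'v : volume K' = ENNReal.ofReal ((1 / 2) ^ n) * volume K := by
    rw [hK', Measure.addHaar_image_homothety, finrank_euclideanSpace_fin, abs_of_pos (by positivity)]
  have himage : gradient f '' K' ⊆ {p | ∀ z ∈ K, ⟪p, z - c⟫ ≤ 2} := by
    rintro _ ⟨_, ⟨k, hk, rfl⟩, rfl⟩ z hz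
    set x := AffineMap.homothety c (1 / 2 : ℝ) k with hx
    have hxe : x = (1 / 2 : ℝ) • (k - c) + c := by simp [hx, AffineMap.homothety_apply]
    have hy : (1 / 2 : ℝ) • k + (1 / 2 : ℝ) • z ∈ K :=
      hKc hk hz (by norm_num) (by norm_num) (by norm_num)
    have h := hconv.add_inner_gradient_le (hd x) ((1 / 2 : ℝ) • k + (1 / 2 : ℝ) • z)
    have hyx : (1 / 2 : ℝ) • k + (1 / 2 : ℝ) • z - x = (1 / 2 : ℝ) • (z - c) := by
      rw [hxe]
      module
    rw [hyx, inner_smul_right] at h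
    have := hnonneg x
    have : f ((1 / 2 : ℝ) • k + (1 / 2 : ℝ) • z) ≤ 1 := hy
    linarith
  have hexp := (ofReal_mul_volume_le_volume_gradient_image hf hconv hlam
    ((hKc.affine_image _).nullMeasurableSet volume) fun x hx => hdet x (hsub hx)).trans
      (measure_mono himage)
  have hmul := ENNReal.toReal_mono hC ((mul_le_mul_right hexp (volume K)).trans hle)
  rw [hK'v] at hmul
  simp only [ENNReal.toReal_mul, ENNReal.toReal_ofReal hlam.le,
    ENNReal.toReal_ofReal (by positivity : (0 : ℝ) ≤ (1 / 2) ^ n)] at hmul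
  set V := (volume K).toReal with hV
  have hsq : V ^ 2 * lam ≤ 2 ^ n * C.toReal := by
    have h2 : (2 : ℝ) ^ n * (1 / 2) ^ n = 1 := by rw [← mul_pow]; norm_num
    calc V ^ 2 * lam = 2 ^ n * (V * (lam * ((1 / 2) ^ n * V))) := by
          linear_combination (-(V ^ 2 * lam)) * h2
      _ ≤ _ := by gcongr
  have hrpow : lam ^ (-(1 : ℝ) / 2) = (√lam)⁻¹ := by
    rw [neg_div, Real.rpow_neg hlam.le, ← Real.sqrt_eq_rpow]
  rw [hrpow, ← div_eq_mul_inv, le_div_iff₀ (Real.sqrt_pos.2 hlam)]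
  refine Real.le_sqrt_of_sq_le ?_
  rwa [mul_pow, Real.sq_sqrt hlam.le]
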